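/- arXiv:2307.14549 — 4 statements merged into one kernel-verified Lean document; each statement's English description precedes it below -/
import Mathlib

section
/- Let (Ω, F, P) be a probability space, let q, ℓ ∈ [0,1] and λ ∈ (0,1] and δ ∈ (0,1) be constants, and let q̂ : Ω → [0,∞) be a nonnegative random variable such that P(|q̂ − q| > λ) ≤ δ. Then E[q·ℓ/(q̂ + λ)] ≤ ℓ + δ/λ. -/
open MeasureTheory

/-- Abstract form of the loss-estimate bound (following Lemma 4 of Saha et al.):
if `q, ℓ ∈ [0,1]`, `λ ∈ (0,1]`, `δ ∈ (0,1)`, and the nonnegative random variable `q̂`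
satisfies `P(|q̂ − q| > λ) ≤ δ`, then `E[q·ℓ/(q̂+λ)] ≤ ℓ + δ/λ`. -/
theorem expected_loss_estimate_bound
    {Ω : Type*} [MeasurableSpace Ω] (P : Measure Ω) [IsProbabilityMeasure P]
    (q ℓ lam δ : ℝ)
    (hq : q ∈ Set.Icc (0 : ℝ) 1) (hl : ℓ ∈ Set.Icc (0 : ℝ) 1)
    (hlam : lam ∈ Set.Ioc (0 : ℝ) 1) (hδ : δ ∈ Set.Ioo (0 : ℝ) 1)
    (qhat : Ω → ℝ) (hmeas : Measurable qhat) (hnonneg : ∀ ω, 0 ≤ qhat ω)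
    (hconc : P {ω | lam < |qhat ω - q|} ≤ ENNReal.ofReal δ) :
    ∫ ω, q * ℓ / (qhat ω + lam) ∂P ≤ ℓ + δ / lam := by
  obtain ⟨hq0, hq1⟩ := hq
  obtain ⟨hl0, hl1⟩ := hl
  have hlam0 : 0 < lam := hlam.1
  set B : Set Ω := {ω | lam < |qhat ω - q|}
  have hBm : MeasurableSet B :=
    measurableSet_lt measurable_const (hmeas.sub_const q).abs
  have hBδ : P.real B ≤ δ := ENNReal.toReal_le_of_le_ofReal hδ.1.le hconc
  have hpos : ∀ ω, 0 < qhat ω + lam := fun ω => add_pos_of_nonneg_of_pos (hnonneg ω) hlam0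
  have hint : Integrable (B.indicator fun _ => 1 / lam) P := (integrable_const _).indicator hBm
  have hle : ∀ ω, q * ℓ / (qhat ω + lam) ≤ ℓ + B.indicator (fun _ => 1 / lam) ω := by
    intro ω
    by_cases hω : ω ∈ B
    · rw [Set.indicator_of_mem hω]
      have : q * ℓ / (qhat ω + lam) ≤ 1 / lam :=
        div_le_div₀ zero_le_one (mul_le_one₀ hq1 hl0 hl1) hlam0
          (le_add_of_nonneg_left (hnonneg ω))
      linarith
    · rw [Set.indicator_of_notMem hω, add_zero, div_le_iff₀ (hpos ω), mul_comm]
      have hω' : |qhat ω - q| ≤ lam := not_lt.mp hω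
      exact mul_le_mul_of_nonneg_left (by linarith [(abs_le.mp hω').1]) hl0
  calc ∫ ω, q * ℓ / (qhat ω + lam) ∂P
      ≤ ∫ ω, (ℓ + B.indicator (fun _ => 1 / lam) ω) ∂P :=
        integral_mono_of_nonneg
          (.of_forall fun ω => div_nonneg (mul_nonneg hq0 hl0) (hpos ω).le)
          ((integrable_const _).add hint) (.of_forall hle)
    _ = ℓ + P.real B / lam := by
        rw [integral_add (integrable_const _) hint, integral_indicator_const _ hBm]
        simp [div_eq_mul_inv]
    _ ≤ ℓ + δ / lam := by gcongr
end

section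
/- Let N and k be positive integers with k ≤ N, and let P_k' = {p ∈ ℝ^N : 0 ≤ p(i) ≤ 1 for all i, and Σ_{i=1}^N p(i) = k}. Then every p ∈ P_k' can be written as a convex combination p = Σ_Ω w_Ω 1_Ω, where the sum ranges over k-element subsets Ω ⊆ {1,...,N}, 1_Ω ∈ {0,1}^N is the indicator vector of Ω, the coefficients satisfy w_Ω ≥ 0 and Σ_Ω w_Ω = 1, and at most N of the coefficients w_Ω are nonzero. Moreover, the support of every Ω with w_Ω > 0 can be taken inside the support of p. -/
open scoped Classical

/-- If `0 ≤ p i ≤ t` and `∑ i, p i = k * t`, there is a `k`-element set between the set of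
coordinates at the cap `t` and the support of `p`. -/
lemma exists_card_eq_between_cap_and_support {ι : Type*} [Fintype ι] [DecidableEq ι]
    {k : ℕ} {t : ℝ} (ht : 0 < t) {p : ι → ℝ} (hp : ∀ i, 0 ≤ p i ∧ p i ≤ t)
    (hsum : ∑ i, p i = k * t) :
    ∃ Ω : Finset ι, Ω.card = k ∧ (∀ i, p i = t → i ∈ Ω) ∧ ∀ i ∈ Ω, 0 < p i := by
  have hcap : (Finset.univ.filter fun i => p i = t).card ≤ k := by
    have h : ∑ i ∈ Finset.univ.filter (fun i => p i = t), p i ≤ k * t :=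
      hsum ▸ Finset.sum_le_sum_of_subset_of_nonneg (Finset.subset_univ _) fun i _ _ => (hp i).1
    rw [Finset.sum_congr rfl (fun i hi => (Finset.mem_filter.1 hi).2), Finset.sum_const,
      nsmul_eq_mul] at h
    exact_mod_cast le_of_mul_le_mul_right h ht
  have hsupp : k ≤ (Finset.univ.filter fun i => 0 < p i).card := by
    have h : ∑ i ∈ Finset.univ.filter (fun i => 0 < p i), p i = k * t := by
      rw [← hsum]
      refine Finset.sum_subset (Finset.subset_univ _) fun i _ hi => ?_
      have := (hp i).1
      simp only [Finset.mem_filter, Finset.mem_univ, true_and, not_lt] at hi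
      linarith
    have h' := Finset.sum_le_card_nsmul (Finset.univ.filter fun i => 0 < p i) p t
      fun i _ => (hp i).2
    rw [h, nsmul_eq_mul] at h'
    exact_mod_cast le_of_mul_le_mul_right h' ht
  obtain ⟨Ω, h₁, h₂, h₃⟩ := Finset.exists_subsuperset_card_eq
    (s := Finset.univ.filter fun i => p i = t) (t := Finset.univ.filter fun i => 0 < p i)
    (fun i hi => by
      simp only [Finset.mem_filter, Finset.mem_univ, true_and] at hi ⊢
      exact hi ▸ ht) hcap hsupp
  exact ⟨Ω, h₃, fun i hi => h₁ (by simpa using hi), fun i hi => by simpa using h₂ hi⟩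

/-- A vector with `0 ≤ p i ≤ t` whose sum is an integer multiple of `t` cannot have exactly one
coordinate strictly between `0` and `t`. -/
lemma card_filter_pos_lt_cap_ne_one {ι : Type*} [Fintype ι] [DecidableEq ι]
    {k : ℕ} {t : ℝ} (ht : 0 < t) {p : ι → ℝ} (hp : ∀ i, 0 ≤ p i ∧ p i ≤ t)
    (hsum : ∑ i, p i = k * t) :
    (Finset.univ.filter fun i => 0 < p i ∧ p i < t).card ≠ 1 := by
  intro h
  obtain ⟨j, hj⟩ := Finset.card_eq_one.1 h
  have hmem : ∀ i, (0 < p i ∧ p i < t) ↔ i = j := fun i => by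
    simpa using Finset.ext_iff.1 hj i
  obtain ⟨hj₀, hj₁⟩ := (hmem j).2 rfl
  have hrest : ∑ i ∈ Finset.univ.erase j, p i =
      ((Finset.univ.erase j).filter fun i => p i = t).card * t := by
    rw [← nsmul_eq_mul, ← Finset.sum_const, Finset.sum_filter]
    refine Finset.sum_congr rfl fun i hi => ?_
    split_ifs with hit
    · exact hit
    · by_contra h0
      exact Finset.ne_of_mem_erase hi
        ((hmem i).1 ⟨lt_of_le_of_ne (hp i).1 (Ne.symm h0), lt_of_le_of_ne (hp i).2 hit⟩)
  rw [← Finset.add_sum_erase _ _ (Finset.mem_univ j), hrest] at hsum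
  set a := ((Finset.univ.erase j).filter fun i => p i = t).card
  have h₁ : (a : ℝ) < k := lt_of_mul_lt_mul_right (by linarith) ht.le
  have h₂ : (k : ℝ) < (a + 1 : ℕ) :=
    lt_of_mul_lt_mul_right (by push_cast; linarith) ht.le
  have h₃ : a < k := by exact_mod_cast h₁
  have h₄ : k < a + 1 := by exact_mod_cast h₂
  omega

/-- Scaled mixture decomposition, with the number of nonzero weights controlled by the number of
coordinates strictly between `0` and the cap `t`. -/
lemma exists_mixture_card_le_max {ι : Type*} [Fintype ι] [DecidableEq ι] [Nonempty ι]
    {k : ℕ} {t : ℝ} (ht : 0 < t) {p : ι → ℝ} (hp : ∀ i, 0 ≤ p i ∧ p i ≤ t)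
    (hsum : ∑ i, p i = k * t) :
    ∃ w : Finset ι → ℝ,
      (∀ Ω, 0 ≤ w Ω) ∧
      (∑ Ω : Finset ι, w Ω) = t ∧
      (∀ Ω : Finset ι, w Ω ≠ 0 → Ω.card = k ∧ ∀ i ∈ Ω, 0 < p i) ∧
      (∀ i, p i = ∑ Ω ∈ Finset.univ.filter (fun Ω : Finset ι => i ∈ Ω), w Ω) ∧
      (Finset.univ.filter (fun Ω : Finset ι => w Ω ≠ 0)).card ≤
        max 1 (Finset.univ.filter fun i => 0 < p i ∧ p i < t).card := by
  induction hn : (Finset.univ.filter fun i => 0 < p i ∧ p i < t).card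
    using Nat.strong_induction_on generalizing t p with
  | _ n ih =>
  obtain ⟨Ω, hcard, hcap, hsupp⟩ := exists_card_eq_between_cap_and_support ht hp hsum
  obtain ⟨j, hj⟩ := Finite.exists_min fun i => if i ∈ Ω then p i else t - p i
  obtain ⟨s, hs⟩ : ∃ s, s = if j ∈ Ω then p j else t - p j := ⟨_, rfl⟩
  simp only [← hs] at hj
  have hin : ∀ i ∈ Ω, s ≤ p i := fun i hi => by simpa [hi] using hj i
  have hout : ∀ i, i ∉ Ω → s ≤ t - p i := fun i hi => by simpa [hi] using hj i
  have hs₀ : 0 < s := by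
    rw [hs]
    split_ifs with h
    · exact hsupp j h
    · exact sub_pos.2 (lt_of_le_of_ne (hp j).2 fun h' => h (hcap j h'))
  have hst : s ≤ t := by
    have := hp j
    rw [hs]
    split_ifs <;> linarith
  rcases hst.eq_or_lt with rfl | hst
  · refine ⟨fun Ω' => if Ω' = Ω then s else 0, fun Ω' => ?_, by simp, fun Ω' h => ?_,
      fun i => ?_, ?_⟩
    · dsimp only
      split_ifs <;> simp [hs₀.le]
    · have : Ω' = Ω := by
        by_contra h'
        simp [h'] at h
      exact this ▸ ⟨hcard, hsupp⟩
    · have := hp i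
      by_cases hi : i ∈ Ω
      · have := hin i hi
        simp [Finset.sum_ite_eq', hi]
        linarith
      · have := hout i hi
        simp [Finset.sum_ite_eq', hi]
        linarith
    · refine le_max_of_le_left ((Finset.card_le_card (t := {Ω}) fun Ω' h => ?_).trans (by simp))
      by_contra h'
      rw [Finset.mem_singleton] at h'
      simp [h'] at h
  · have hlt : (Finset.univ.filter fun i => 0 < p i - (if i ∈ Ω then s else 0) ∧
        p i - (if i ∈ Ω then s else 0) < t - s).card < n := by
      rw [← hn]
      refine Finset.card_lt_card (Finset.ssubset_iff_of_subset (fun i hi => ?_) |>.2 ⟨j, ?_, ?_⟩)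
      · simp only [Finset.mem_filter, Finset.mem_univ, true_and] at hi ⊢
        split_ifs at hi <;> constructor <;> linarith
      · simp only [Finset.mem_filter, Finset.mem_univ, true_and]
        split_ifs at hs <;> constructor <;> linarith
      · simp only [Finset.mem_filter, Finset.mem_univ, true_and]
        rintro ⟨h₁, h₂⟩
        split_ifs at hs h₁ h₂ <;> linarith
    obtain ⟨w, hw₀, hw₁, hw₂, hw₃, hw₄⟩ := ih _ hlt (t := t - s)
      (p := fun i => p i - if i ∈ Ω then s else 0) (sub_pos.2 hst)
      (fun i => by
        have := hp i
        split_ifs with hi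
        · have := hin i hi
          constructor <;> linarith
        · have := hout i hi
          constructor <;> linarith)
      (by
        rw [Finset.sum_sub_distrib, hsum, Finset.sum_ite_mem, Finset.univ_inter,
          Finset.sum_const, hcard, nsmul_eq_mul]
        ring) rfl
    refine ⟨fun Ω' => w Ω' + if Ω' = Ω then s else 0, fun Ω' => ?_, ?_, fun Ω' h => ?_,
      fun i => ?_, ?_⟩
    · have := hw₀ Ω'
      dsimp only
      split_ifs <;> linarith
    · simp [Finset.sum_add_distrib, hw₁]
    · by_cases h' : Ω' = Ω
      · exact h' ▸ ⟨hcard, hsupp⟩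
      · obtain ⟨hc, hpos⟩ := hw₂ Ω' (by simpa [h'] using h)
        refine ⟨hc, fun i hi => ?_⟩
        have := hpos i hi
        split_ifs at this <;> linarith
    · rw [Finset.sum_add_distrib, ← hw₃ i]
      simp [Finset.sum_ite_eq']
    · have hle : (Finset.univ.filter fun Ω' => w Ω' + (if Ω' = Ω then s else 0) ≠ 0).card ≤
          (Finset.univ.filter fun Ω' => w Ω' ≠ 0).card + 1 := by
        refine (Finset.card_le_card fun Ω' h => ?_).trans (Finset.card_insert_le Ω _)
        by_cases h' : Ω' = Ω <;> simp_all
      have hne : n ≠ 1 := hn ▸ card_filter_pos_lt_cap_ne_one ht hp hsum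
      refine hle.trans ?_
      omega

/-- Mixture decomposition (Warmuth–Kuzmin): every vector in the `k`-scaled capped simplex
`P_k' = {p ∈ ℝ^N : 0 ≤ p(i) ≤ 1, Σ_i p(i) = k}` is a convex combination of indicator
vectors of `k`-element subsets, with at most `N` nonzero coefficients, and every subset
appearing with nonzero weight is contained in the support of `p`. -/
theorem capped_simplex_mixture_decomposition
    (N k : ℕ) (hk : 0 < k) (hkN : k ≤ N)
    (p : Fin N → ℝ) (hp : ∀ i, 0 ≤ p i ∧ p i ≤ 1) (hsum : ∑ i, p i = (k : ℝ)) :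
    ∃ w : Finset (Fin N) → ℝ,
      (∀ Ω, 0 ≤ w Ω) ∧
      (∑ Ω : Finset (Fin N), w Ω) = 1 ∧
      (∀ Ω : Finset (Fin N), w Ω ≠ 0 → Ω.card = k ∧ ∀ i ∈ Ω, 0 < p i) ∧
      (∀ i, p i = ∑ Ω ∈ Finset.univ.filter (fun Ω : Finset (Fin N) => i ∈ Ω), w Ω) ∧
      (Finset.univ.filter (fun Ω : Finset (Fin N) => w Ω ≠ 0)).card ≤ N := by
  have : Nonempty (Fin N) := ⟨⟨0, hk.trans_le hkN⟩⟩
  obtain ⟨w, h₀, h₁, h₂, h₃, h₄⟩ := exists_mixture_card_le_max one_pos hp (by simpa using hsum)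
  refine ⟨w, h₀, h₁, h₂, h₃, h₄.trans (max_le (hk.trans_le hkN) ?_)⟩
  simpa using Finset.card_le_univ (Finset.univ.filter fun i => 0 < p i ∧ p i < 1)
end

section
/- Let N and k be positive integers with k ≤ N, and let p ∈ ℝ^N be a probability vector (p(i) ≥ 0 for all i, Σ_i p(i) = 1) having at least k strictly positive components. Then there exists m ∈ {0, 1, ..., k−1} such that the vector p̂ defined by setting the m largest components of p to 1/k and multiplying each of the remaining components p(j) by (k−m)/(k·Σ_{l>m} p^↓(l)) (where p^↓ denotes p sorted in decreasing order and the sum is over the N−m smallest components) is a probability vector with p̂(i) ≤ 1/k for all i; i.e., p̂ ∈ P_k = {q ∈ ℝ^N : Σ_i q(i) = 1, 0 ≤ q(i) ≤ 1/k}. Consequently, the iterative capping procedure of Algorithm 2 terminates after at most k−1 capping iterations and outputs a vector in P_k. -/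
open scoped Classical

/-- `σ` sorts `p` in decreasing order: `p(σ(0)) ≥ p(σ(1)) ≥ …`. -/
def IsSortingPerm {N : ℕ} (p : Fin N → ℝ) (σ : Equiv.Perm (Fin N)) : Prop :=
  ∀ i j : Fin N, i ≤ j → p (σ j) ≤ p (σ i)

/-- One capping step with parameter `m` (relative to a sorting permutation `σ`):
the `m` largest components of `p` are set to `1/k`, and each remaining component
`p(j)` is multiplied by `(k−m)/(k · Σ_{l>m} p^↓(l))`. -/
noncomputable def capAt (N k : ℕ) (σ : Equiv.Perm (Fin N)) (m : ℕ) (p : Fin N → ℝ) :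
    Fin N → ℝ :=
  fun i =>
    if ((σ.symm i : ℕ) < m) then 1 / (k : ℝ)
    else ((k : ℝ) - m) / k * p i /
      ∑ j ∈ Finset.univ.filter (fun j : Fin N => m ≤ ((σ.symm j : ℕ))), p j

/-- Exactly `m` indices have rank less than `m` under a permutation of `Fin N`. -/
lemma card_filter_symm_lt {N m : ℕ} (hm : m ≤ N) (σ : Equiv.Perm (Fin N)) :
    (Finset.univ.filter (fun i : Fin N => (σ.symm i : ℕ) < m)).card = m := by
  have h : (Finset.univ.filter (fun i : Fin N => (σ.symm i : ℕ) < m)).card =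
      (Finset.univ.filter (fun i : Fin N => (i : ℕ) < m)).card :=
    Finset.card_equiv σ.symm (by simp)
  rw [h, Fin.card_filter_val_lt, min_eq_right hm]

/-- Capping preserves total mass `1` as long as the uncapped mass is nonzero. -/
lemma sum_capAt {N k m : ℕ} (hk : 0 < k) (hm : m ≤ N) (σ : Equiv.Perm (Fin N))
    (p : Fin N → ℝ)
    (hT : ∑ j ∈ Finset.univ.filter (fun j : Fin N => m ≤ (σ.symm j : ℕ)), p j ≠ 0) :
    ∑ i, capAt N k σ m p i = 1 := by
  have hk' : (k : ℝ) ≠ 0 := by positivity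
  unfold capAt
  rw [Finset.sum_ite, Finset.sum_const, card_filter_symm_lt hm]
  simp only [not_lt]
  rw [← Finset.sum_div, ← Finset.mul_sum, mul_div_assoc, div_self hT, nsmul_eq_mul]
  field_simp
  ring

/-- If `p` has more than `m` positive components, then its mass on the indices of rank at
least `m` is positive. -/
lemma sum_filter_le_symm_pos {N m : ℕ} (hm : m ≤ N) (σ : Equiv.Perm (Fin N))
    {p : Fin N → ℝ} (hp : ∀ i, 0 ≤ p i)
    (hsupp : m < (Finset.univ.filter (fun i : Fin N => 0 < p i)).card) :
    0 < ∑ j ∈ Finset.univ.filter (fun j : Fin N => m ≤ (σ.symm j : ℕ)), p j := by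
  obtain ⟨i, hi, hi'⟩ := Finset.exists_mem_notMem_of_card_lt_card
    ((card_filter_symm_lt hm σ).trans_lt hsupp)
  simp only [Finset.mem_filter, Finset.mem_univ, true_and, not_lt] at hi hi'
  exact Finset.sum_pos' (fun j _ => hp j) ⟨i, by simpa using hi', hi⟩

/-- Termination of the iterative capping procedure (Algorithm 2, following Algorithm 4 of
Warmuth–Kuzmin): for any probability vector `p` with at least `k` strictly positive
components and any permutation sorting `p` decreasingly, there is `m ∈ {0,…,k−1}` such
that capping the `m` largest components at `1/k` and rescaling the rest yields a vector in
the capped simplex `P_k = {q : Σ_i q(i) = 1, 0 ≤ q(i) ≤ 1/k}`. -/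
theorem capping_procedure_terminates
    (N k : ℕ) (hk : 0 < k) (hkN : k ≤ N)
    (p : Fin N → ℝ) (hp : ∀ i, 0 ≤ p i) (hsum : ∑ i, p i = 1)
    (hsupp : k ≤ (Finset.univ.filter (fun i : Fin N => 0 < p i)).card)
    (σ : Equiv.Perm (Fin N)) (hσ : IsSortingPerm p σ) :
    ∃ m : ℕ, m < k ∧
      (∀ i, 0 ≤ capAt N k σ m p i ∧ capAt N k σ m p i ≤ 1 / (k : ℝ)) ∧
      ∑ i, capAt N k σ m p i = 1 := by
  obtain ⟨m, rfl⟩ : ∃ m, k = m + 1 := ⟨k - 1, by omega⟩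
  have hT := sum_filter_le_symm_pos (by omega : m ≤ N) σ hp (by omega)
  refine ⟨m, m.lt_succ_self, fun i => ?_, sum_capAt hk (by omega) σ p hT.ne'⟩
  have hcoef : ((m + 1 : ℕ) : ℝ) - m = 1 := by push_cast; ring
  unfold capAt
  rw [hcoef]
  split_ifs with hi
  · exact ⟨by positivity, le_rfl⟩
  · have hle : p i ≤ ∑ j ∈ Finset.univ.filter (fun j : Fin N => m ≤ (σ.symm j : ℕ)), p j :=
      Finset.single_le_sum (fun j _ => hp j) (by simpa using hi)
    have hpi := hp i
    refine ⟨by positivity, ?_⟩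
    rw [mul_div_assoc]
    exact mul_le_of_le_one_right (by positivity) ((div_le_one hT).2 hle)
end

section
/- Let N and k be positive integers with k ≤ N, let η > 0, and let ℓ̂_1, ..., ℓ̂_T ∈ [0,∞)^N be loss vectors with η·ℓ̂_t(i) ≤ 1 for all t and i. Define weights w_1(i) = 1 and w_{t+1}(i) = w_t(i)·exp(−η ℓ̂_t(i)), and at each t let q_t = k·cap_k(p_t), where p_t(i) = w_t(i)/Σ_j w_t(j) and cap_k denotes the projection of a probability vector onto the capped simplex P_k = {q : Σ_i q(i) = 1, 0 ≤ q(i) ≤ 1/k} computed by the iterative capping procedure (set the smallest number m of largest components to 1/k and rescale the rest proportionally so that all entries are at most 1/k). Then for every k-element subset U ⊆ {1,...,N}: Σ_{t=1}^T ⟨ℓ̂_t, q_t⟩ − Σ_{t=1}^T Σ_{j∈U} ℓ̂_t(j) ≤ (k·ln(N/k))/η + k·η·Σ_{t=1}^T ⟨ℓ̂_t², q_t⟩, where ℓ̂_t² denotes the coordinatewise square. -/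
open scoped Classical

/-- `c` is the output of the iterative capping procedure applied to `p`: for some
permutation sorting `p` decreasingly, `c` is obtained by capping the smallest number
`m ≤ k−1` of largest components at `1/k` (and proportionally rescaling the rest) for
which all entries become at most `1/k`. -/
def IsCapOf (N k : ℕ) (p c : Fin N → ℝ) : Prop :=
  ∃ σ : Equiv.Perm (Fin N), IsSortingPerm p σ ∧
    ∃ m : ℕ, m < k ∧ c = capAt N k σ m p ∧ (∀ i, c i ≤ 1 / (k : ℝ)) ∧
      ∀ m' : ℕ, m' < m → ∃ i, 1 / (k : ℝ) < capAt N k σ m' p i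

/-- The relative entropy of two nonnegative numbers dominates their difference. -/
theorem sub_le_mul_log_sub_log {x y : ℝ} (hx : 0 < x) (hy : 0 < y) :
    x - y ≤ x * (Real.log x - Real.log y) := by
  have h := Real.log_le_sub_one_of_pos (div_pos hy hx)
  rw [Real.log_div hy.ne' hx.ne'] at h
  have h2 := mul_le_mul_of_nonneg_left h hx.le
  have h3 : x * (y / x - 1) = y - x := by field_simp
  rw [h3] at h2
  linarith

theorem exp_neg_le_one_sub_add_sq {x : ℝ} (h0 : 0 ≤ x) (h1 : x ≤ 1) :
    Real.exp (-x) ≤ 1 - x + x ^ 2 := by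
  have h := Real.abs_exp_sub_one_sub_id_le (x := -x) (by rw [abs_neg, abs_of_nonneg h0]; exact h1)
  have h2 := (abs_le.mp h).2
  nlinarith

section Capping

variable {N k : ℕ} {σ : Equiv.Perm (Fin N)} {m : ℕ} {p c : Fin N → ℝ}

theorem capAt_of_lt {i : Fin N} (hi : (σ.symm i : ℕ) < m) :
    capAt N k σ m p i = 1 / (k : ℝ) := by
  simp [capAt, hi]

theorem capAt_of_le {i : Fin N} (hi : m ≤ (σ.symm i : ℕ)) :
    capAt N k σ m p i = ((k : ℝ) - m) / k * p i /
      ∑ j ∈ Finset.univ.filter (fun j : Fin N => m ≤ ((σ.symm j : ℕ))), p j := by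
  simp [capAt, not_lt.mpr hi]

theorem sum_tail_pos (hp : ∀ i, 0 < p i) (hm : m < N) :
    0 < ∑ j ∈ Finset.univ.filter (fun j : Fin N => m ≤ ((σ.symm j : ℕ))), p j :=
  Finset.sum_pos (fun i _ => hp i) ⟨σ ⟨m, hm⟩, by simp⟩

theorem sum_tail_eq_add (hm : m < N) :
    ∑ j ∈ Finset.univ.filter (fun j : Fin N => m ≤ ((σ.symm j : ℕ))), p j
      = p (σ ⟨m, hm⟩)
        + ∑ j ∈ Finset.univ.filter (fun j : Fin N => m + 1 ≤ ((σ.symm j : ℕ))), p j := by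
  have h : Finset.univ.filter (fun j : Fin N => m ≤ ((σ.symm j : ℕ)))
      = insert (σ ⟨m, hm⟩) (Finset.univ.filter (fun j : Fin N => m + 1 ≤ ((σ.symm j : ℕ)))) := by
    ext j
    simp only [Finset.mem_filter, Finset.mem_univ, true_and, Finset.mem_insert,
      ← Equiv.symm_apply_eq, Fin.ext_iff]
    omega
  rw [h, Finset.sum_insert (by simp)]

theorem capAt_pos (hp : ∀ i, 0 < p i) (hmk : m < k) (hkN : k ≤ N) (i : Fin N) :
    0 < capAt N k σ m p i := by
  have hk : (0 : ℝ) < k := by exact_mod_cast (by omega : 0 < k)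
  have hmk' : (0 : ℝ) < k - m := sub_pos.mpr (by exact_mod_cast hmk)
  rcases lt_or_ge (σ.symm i : ℕ) m with hi | hi
  · rw [capAt_of_lt hi]; positivity
  · rw [capAt_of_le hi]
    have := sum_tail_pos (σ := σ) hp (hmk.trans_le hkN)
    have := hp i
    positivity

theorem sum_capAt_s7 (hp : ∀ i, 0 < p i) (hmk : m < k) (hkN : k ≤ N) :
    ∑ i, capAt N k σ m p i = 1 := by
  have hk : (0 : ℝ) < k := by exact_mod_cast (by omega : 0 < k)
  have hS := sum_tail_pos (σ := σ) hp (hmk.trans_le hkN)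
  have hcard : (Finset.univ.filter (fun i : Fin N => (σ.symm i : ℕ) < m)).card = m := by
    rw [Finset.card_equiv (t := Finset.univ.filter (fun i : Fin N => (i : ℕ) < m)) σ.symm
      (by simp), Fin.card_filter_val_lt]
    omega
  rw [← Finset.sum_filter_add_sum_filter_not Finset.univ (fun i : Fin N => (σ.symm i : ℕ) < m),
    Finset.sum_congr rfl (g := fun _ => 1 / (k : ℝ))
      (fun i hi => capAt_of_lt (Finset.mem_filter.mp hi).2),
    Finset.sum_const, hcard]
  simp only [not_lt]
  rw [Finset.sum_congr rfl fun i hi => capAt_of_le (Finset.mem_filter.mp hi).2,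
    ← Finset.sum_div, ← Finset.mul_sum, mul_div_assoc, div_self hS.ne', nsmul_eq_mul]
  field_simp
  ring

/-- If capping `m` components does not suffice, then the `m`-th largest component (counted from
`0`) is still at least `1/k` after the rescaling that accompanies capping `m + 1` components. -/
theorem sum_tail_le_of_lt_capAt (hp : ∀ i, 0 < p i) (hσ : IsSortingPerm p σ) (hmk : m < k)
    (hm : m < N) {i : Fin N} (hi : 1 / (k : ℝ) < capAt N k σ m p i) :
    ∑ j ∈ Finset.univ.filter (fun j : Fin N => m + 1 ≤ ((σ.symm j : ℕ))), p j
      ≤ ((k : ℝ) - (m + 1 : ℕ)) * p (σ ⟨m, hm⟩) := by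
  have hk : (0 : ℝ) < k := by exact_mod_cast (by omega : 0 < k)
  have hmk' : (0 : ℝ) < k - m := sub_pos.mpr (by exact_mod_cast hmk)
  rcases lt_or_ge (σ.symm i : ℕ) m with h | h
  · rw [capAt_of_lt h] at hi
    exact absurd hi (lt_irrefl _)
  · have hS := sum_tail_pos (σ := σ) hp hm
    rw [capAt_of_le h, lt_div_iff₀ hS, sum_tail_eq_add hm] at hi
    have hle : p i ≤ p (σ ⟨m, hm⟩) := by
      simpa using hσ ⟨m, hm⟩ (σ.symm i) h
    have hi' := mul_lt_mul_of_pos_left hi hk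
    have e : (k : ℝ) * (((k : ℝ) - m) / k * p i) = (k - m) * p i := by field_simp
    rw [e, ← mul_assoc, mul_one_div_cancel hk.ne', one_mul] at hi'
    have := mul_le_mul_of_nonneg_left hle hmk'.le
    push_cast
    linarith

/-- First-order optimality of the capped vector for the relative entropy to `p` over the capped
simplex. -/
theorem IsCapOf.sum_sub_mul_log_nonneg (hp : ∀ i, 0 < p i) (hkN : k ≤ N) (h : IsCapOf N k p c)
    {u : Fin N → ℝ} (hu : ∀ i, u i ≤ 1 / (k : ℝ)) (hu1 : ∑ i, u i = 1) :
    0 ≤ ∑ i, (u i - c i) * (Real.log (c i) - Real.log (p i)) := by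
  obtain ⟨σ, hσ, m, hmk, rfl, -, hmin⟩ := h
  have hk : (0 : ℝ) < k := by exact_mod_cast (by omega : 0 < k)
  have hmk' : (0 : ℝ) < k - m := sub_pos.mpr (by exact_mod_cast hmk)
  have hS := sum_tail_pos (σ := σ) hp (hmk.trans_le hkN)
  set S := ∑ j ∈ Finset.univ.filter (fun j : Fin N => m ≤ ((σ.symm j : ℕ))), p j with hSdef
  have hs : 0 < ((k : ℝ) - m) / k / S := by positivity
  have hshift : ∑ i, (u i - capAt N k σ m p i) * Real.log (((k : ℝ) - m) / k / S) = 0 := by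
    rw [← Finset.sum_mul, Finset.sum_sub_distrib, hu1, sum_capAt_s7 hp hmk hkN, sub_self, zero_mul]
  rw [← hshift]
  refine Finset.sum_le_sum fun i _ => ?_
  rcases lt_or_ge (σ.symm i : ℕ) m with hi | hi
  · refine mul_le_mul_of_nonpos_left ?_ (by rw [capAt_of_lt hi]; linarith [hu i])
    rw [capAt_of_lt hi, sub_le_iff_le_add, ← Real.log_mul hs.ne' (hp i).ne']
    refine Real.log_le_log (by positivity) ?_
    obtain ⟨m, rfl⟩ : ∃ n, m = n + 1 := ⟨m - 1, by omega⟩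
    obtain ⟨j, hj⟩ := hmin m (Nat.lt_succ_self m)
    have hmN : m < N := by omega
    have hle := sum_tail_le_of_lt_capAt hp hσ (by omega) hmN hj
    have hpi : p (σ ⟨m, hmN⟩) ≤ p i := by
      simpa using hσ (σ.symm i) ⟨m, hmN⟩ (Nat.lt_succ_iff.mp hi)
    have hle' := hle.trans (mul_le_mul_of_nonneg_left hpi hmk'.le)
    rw [← hSdef] at hle'
    rw [div_div, div_mul_eq_mul_div, div_le_div_iff₀ hk (by positivity)]
    nlinarith
  · rw [capAt_of_le hi, ← hSdef, mul_div_right_comm, Real.log_mul hs.ne' (hp i).ne',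
      add_sub_cancel_right]

end Capping

/-- Second-order regret bound for the exponentially weighted forecaster with capped
probabilities (Theorem 3.1 of Kale et al., `k`-scaled version): playing
`q_t = k·cap_k(p_t)`, where `p_t` are the normalized exponential weights for the losses
`ℓ̂_t` (with `η ℓ̂_t(i) ≤ 1`), guarantees against every `k`-element subset `U` that
`Σ_t ⟨ℓ̂_t, q_t⟩ − Σ_t Σ_{j∈U} ℓ̂_t(j) ≤ k ln(N/k)/η + kη Σ_t ⟨ℓ̂_t², q_t⟩`. -/
theorem capped_exponential_weights_second_order_regret
    (N k T : ℕ) (hk : 0 < k) (hkN : k ≤ N) (η : ℝ) (hη : 0 < η)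
    (lhat : ℕ → Fin N → ℝ)
    (hlhat_nonneg : ∀ t i, 0 ≤ lhat t i)
    (hlhat_bdd : ∀ t i, η * lhat t i ≤ 1)
    (w : ℕ → Fin N → ℝ)
    (hw_init : ∀ i, w 1 i = 1)
    (hw_rec : ∀ t, 1 ≤ t → ∀ i, w (t + 1) i = w t i * Real.exp (-η * lhat t i))
    (q : ℕ → Fin N → ℝ)
    (hq : ∀ t, ∃ c : Fin N → ℝ,
      IsCapOf N k (fun i => w t i / ∑ j, w t j) c ∧ ∀ i, q t i = k * c i) :
    ∀ U : Finset (Fin N), U.card = k →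
      ∑ t ∈ Finset.Icc 1 T, (∑ i, lhat t i * q t i)
          - ∑ t ∈ Finset.Icc 1 T, ∑ j ∈ U, lhat t j
        ≤ (k : ℝ) * Real.log ((N : ℝ) / k) / η
          + (k : ℝ) * η * ∑ t ∈ Finset.Icc 1 T, ∑ i, (lhat t i) ^ 2 * q t i := by
  intro U hU
  have hkR : (0 : ℝ) < k := by exact_mod_cast hk
  have hNR : (0 : ℝ) < N := by exact_mod_cast hk.trans_le hkN
  have hw : ∀ t i, 0 < w (t + 1) i := by
    intro t i
    induction t with
    | zero => simp [hw_init]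
    | succ t ih => rw [hw_rec (t + 1) (by omega)]; positivity
  have hlogw : ∀ t i, Real.log (w (t + 1 + 1) i)
      = Real.log (w (t + 1) i) - η * lhat (t + 1) i := by
    intro t i
    rw [hw_rec (t + 1) (by omega), Real.log_mul (hw t i).ne' (Real.exp_pos _).ne', Real.log_exp]
    ring
  have hZ : ∀ t, 0 < ∑ j, w (t + 1) j := fun t =>
    Finset.sum_pos (fun i _ => hw t i) ⟨⟨0, by omega⟩, Finset.mem_univ _⟩
  have hp : ∀ t i, 0 < w (t + 1) i / ∑ j, w (t + 1) j := fun t i => div_pos (hw t i) (hZ t)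
  choose c hc hqc using hq
  have hcpos : ∀ t i, 0 < c (t + 1) i := by
    intro t i
    obtain ⟨σ, -, m, hmk, hcm, -⟩ := hc (t + 1)
    rw [hcm]
    exact capAt_pos (hp t) hmk hkN i
  have hcsum : ∀ t, ∑ i, c (t + 1) i = 1 := by
    intro t
    obtain ⟨σ, -, m, hmk, hcm, -⟩ := hc (t + 1)
    rw [hcm]
    exact sum_capAt_s7 (hp t) hmk hkN
  have hcle : ∀ t i, c t i ≤ 1 / (k : ℝ) := by
    intro t
    obtain ⟨σ, -, m, -, -, hle, -⟩ := hc t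
    exact hle
  have hopt : ∀ t (u : Fin N → ℝ), (∀ i, u i ≤ 1 / (k : ℝ)) → ∑ i, u i = 1 →
      ∑ i, c (t + 1) i * (Real.log (c (t + 1) i) - Real.log (w (t + 1) i))
        ≤ ∑ i, u i * (Real.log (c (t + 1) i) - Real.log (w (t + 1) i)) := by
    intro t u hu hu1
    have h := (hc (t + 1)).sum_sub_mul_log_nonneg (hp t) hkN hu hu1
    have hZ0 : ∑ i, (u i - c (t + 1) i) * Real.log (∑ j, w (t + 1) j) = 0 := by
      rw [← Finset.sum_mul, Finset.sum_sub_distrib, hu1, hcsum, sub_self, zero_mul]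
    rw [← sub_nonneg, ← Finset.sum_sub_distrib]
    refine (h.trans_eq (sub_zero _).symm).trans_eq ?_
    rw [← hZ0, ← Finset.sum_sub_distrib]
    refine Finset.sum_congr rfl fun i _ => ?_
    rw [Real.log_div (hw t i).ne' (hZ t).ne']
    ring
  have hstep : ∀ t,
      ∑ i, c (t + 1) i * (Real.log (c (t + 1) i) - Real.log (w (t + 1) i))
        + (η * ∑ i, lhat (t + 1) i * c (t + 1) i
          - η ^ 2 * ∑ i, (lhat (t + 1) i) ^ 2 * c (t + 1) i)
      ≤ ∑ i, c (t + 1 + 1) i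
          * (Real.log (c (t + 1 + 1) i) - Real.log (w (t + 1 + 1) i)) := by
    intro t
    have h := hopt t (c (t + 1 + 1)) (hcle _) (hcsum _)
    have h2 : ∑ i, (c (t + 1 + 1) i - c (t + 1) i
          + η * (lhat (t + 1) i * c (t + 1) i) - η ^ 2 * ((lhat (t + 1) i) ^ 2 * c (t + 1) i))
        ≤ ∑ i, (c (t + 1 + 1) i * (Real.log (c (t + 1 + 1) i) - Real.log (w (t + 1 + 1) i))
          - c (t + 1 + 1) i * (Real.log (c (t + 1) i) - Real.log (w (t + 1) i))) := by
      refine Finset.sum_le_sum fun i _ => ?_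
      have h3 := sub_le_mul_log_sub_log (hcpos (t + 1) i)
        (mul_pos (hcpos t i) (Real.exp_pos (-(η * lhat (t + 1) i))))
      rw [Real.log_mul (hcpos t i).ne' (Real.exp_pos _).ne', Real.log_exp] at h3
      have h4 := mul_le_mul_of_nonneg_left (exp_neg_le_one_sub_add_sq
        (mul_nonneg hη.le (hlhat_nonneg (t + 1) i)) (hlhat_bdd (t + 1) i)) (hcpos t i).le
      rw [hlogw]
      linarith
    simp only [Finset.sum_sub_distrib, Finset.sum_add_distrib, hcsum, ← Finset.mul_sum] at h2
    linarith
  have hinit : -Real.log N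
      ≤ ∑ i, c (0 + 1) i * (Real.log (c (0 + 1) i) - Real.log (w (0 + 1) i)) := by
    have h : ∑ i, (c (0 + 1) i - 1 / (N : ℝ))
        ≤ ∑ i, c (0 + 1) i * (Real.log (c (0 + 1) i) - Real.log (1 / (N : ℝ))) :=
      Finset.sum_le_sum fun i _ => sub_le_mul_log_sub_log (hcpos 0 i) (by positivity)
    simp only [mul_sub, Finset.sum_sub_distrib, ← Finset.sum_mul, hcsum] at h ⊢
    simp [hw_init, hNR.ne'] at h ⊢
    linarith
  have htel : ∀ n, -Real.log N + (η * ∑ t ∈ Finset.Icc 1 n, ∑ i, lhat t i * c t i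
        - η ^ 2 * ∑ t ∈ Finset.Icc 1 n, ∑ i, (lhat t i) ^ 2 * c t i)
      ≤ ∑ i, c (n + 1) i * (Real.log (c (n + 1) i) - Real.log (w (n + 1) i)) := by
    intro n
    induction n with
    | zero => simpa using hinit
    | succ n ih =>
      rw [Finset.sum_Icc_succ_top (by omega), Finset.sum_Icc_succ_top (by omega)]
      linarith [hstep n]
  have hlogw_sum : ∀ n i, Real.log (w (n + 1) i) = -(η * ∑ t ∈ Finset.Icc 1 n, lhat t i) := by
    intro n i
    induction n with
    | zero => simp [hw_init]
    | succ n ih =>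
      rw [hlogw, ih, Finset.sum_Icc_succ_top (by omega)]
      ring
  have hcomp : ∑ i, c (T + 1) i * (Real.log (c (T + 1) i) - Real.log (w (T + 1) i))
      ≤ -Real.log k + η / k * ∑ t ∈ Finset.Icc 1 T, ∑ j ∈ U, lhat t j := by
    refine (hopt T (fun i => if i ∈ U then 1 / (k : ℝ) else 0) ?_ ?_).trans ?_
    · intro i
      split_ifs
      · exact le_rfl
      · positivity
    · simp [hU, hkR.ne']
    · simp only [ite_mul, zero_mul, Finset.sum_ite_mem, Finset.univ_inter]
      have h : ∑ i ∈ U, 1 / (k : ℝ) * (Real.log (c (T + 1) i) - Real.log (w (T + 1) i))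
          ≤ ∑ i ∈ U, (1 / (k : ℝ) * (-Real.log k)
            + η / k * ∑ t ∈ Finset.Icc 1 T, lhat t i) := by
        refine Finset.sum_le_sum fun i _ => ?_
        have h1 := Real.log_le_log (hcpos T i) (hcle (T + 1) i)
        rw [one_div, Real.log_inv] at h1
        have h2 := mul_le_mul_of_nonneg_left h1 (one_div_pos.mpr hkR).le
        rw [hlogw_sum]
        linarith [show 1 / (k : ℝ) * (η * ∑ t ∈ Finset.Icc 1 T, lhat t i)
          = η / k * ∑ t ∈ Finset.Icc 1 T, lhat t i by ring]
      refine h.trans_eq ?_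
      rw [Finset.sum_add_distrib, Finset.sum_const, hU, nsmul_eq_mul, ← mul_assoc,
        mul_one_div_cancel hkR.ne', one_mul, ← Finset.mul_sum, Finset.sum_comm]
  have hmain := (htel T).trans hcomp
  have hq1 : ∑ t ∈ Finset.Icc 1 T, ∑ i, lhat t i * q t i
      = k * ∑ t ∈ Finset.Icc 1 T, ∑ i, lhat t i * c t i := by
    simp only [hqc, Finset.mul_sum, mul_left_comm]
  have hq2 : ∑ t ∈ Finset.Icc 1 T, ∑ i, (lhat t i) ^ 2 * q t i
      = k * ∑ t ∈ Finset.Icc 1 T, ∑ i, (lhat t i) ^ 2 * c t i := by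
    simp only [hqc, Finset.mul_sum, mul_left_comm]
  have hB : 0 ≤ ∑ t ∈ Finset.Icc 1 T, ∑ i, (lhat t i) ^ 2 * c t i := by
    refine Finset.sum_nonneg fun t ht => Finset.sum_nonneg fun i _ => ?_
    obtain ⟨n, rfl⟩ : ∃ n, t = n + 1 := ⟨t - 1, by have := (Finset.mem_Icc.mp ht).1; omega⟩
    have := hcpos n i
    positivity
  rw [hq1, hq2, Real.log_div hNR.ne' hkR.ne']
  generalize ∑ t ∈ Finset.Icc 1 T, ∑ i, lhat t i * c t i = A at *
  generalize ∑ t ∈ Finset.Icc 1 T, ∑ i, (lhat t i) ^ 2 * c t i = B at *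
  generalize ∑ t ∈ Finset.Icc 1 T, ∑ j ∈ U, lhat t j = D at *
  have hscaled : k * A - D ≤ k * (Real.log N - Real.log k) / η + k * η * B := by
    have h := mul_le_mul_of_nonneg_left hmain (div_pos hkR hη).le
    have e1 : k / η * (-Real.log N + (η * A - η ^ 2 * B))
        = -(k * Real.log N / η) + k * A - k * η * B := by
      field_simp
      ring
    have e2 : k / η * (-Real.log k + η / k * D) = -(k * Real.log k / η) + D := by
      field_simp
    rw [e1, e2] at h
    rw [mul_sub, sub_div]
    linarith
  have hk1 : (1 : ℝ) ≤ k := by exact_mod_cast hk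
  have hkB : k * η * B ≤ k * η * (k * B) :=
    mul_le_mul_of_nonneg_left (le_mul_of_one_le_left hB hk1) (by positivity)
  linarith
end
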